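/- For every (X,Aut(X))-graph P, the unit component η_P : P → NR(P) of the nerve–realization adjunction R ⊣ N induced by the interpretation I : 𝔾_{(X,Aut(X))} → Set↓Π̲_X is bijective on vertices and surjective on arcs; in particular η_P is an epimorphism, so the adjunction R ⊣ N exhibits Set↓Π̲_X as an epi-reflective subcategory of the presheaf category of (X,Aut(X))-graphs. -/

import Mathlib

open CategoryTheory Limits Opposite

/-- The symmetric `X`-power functor `Π̲_X : Set ⥤ Set`: `Π̲_X(Y)` is the quotient of
`Y^X` by precomposition with the automorphism group `Aut X`. -/
def PiXF (X : Type) : Type ⥤ Type where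
  obj Y := Quot (fun f g : X → Y => ∃ σ : Equiv.Perm X, f = g ∘ σ)
  map {Y Z} h := TypeCat.ofHom (Quot.lift (fun f => Quot.mk _ (h ∘ f)) (by
    rintro f g ⟨σ, rfl⟩
    exact Quot.sound ⟨σ, rfl⟩))
  map_id Y := by
    ext q
    induction q using Quot.ind with
    | _ f => rfl
  map_comp {Y Z W} h k := by
    ext q
    induction q using Quot.ind with
    | _ f => rfl

/-- The category of `Π̲_X`-graphs, the comma category `Set ↓ Π̲_X`. -/
abbrev PiGraph (X : Type) : Type 1 := Comma (𝟭 Type) (PiXF X)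

/-- The two objects of the theory `𝔾_{(X, Aut X)}`. -/
inductive PObj (X : Type) : Type
  | V | A

namespace PObj

/-- Hom-sets of the theory `𝔾_{(X, Aut X)}`: `Hom(V,A) = X`, `Hom(A,A) = Aut X`. -/
def Homs (X : Type) : PObj X → PObj X → Type
  | V, V => PUnit
  | V, A => X
  | A, V => PEmpty
  | A, A => Equiv.Perm X

/-- The theory `𝔾_{(X, Aut X)}`: composition is given by `σ ∘ x = σ(x)` and
`σ ∘ σ' = σ'σ` (the monoid `Aut X` with its diagrammatic multiplication). -/
instance (X : Type) : Category (PObj X) where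
  Hom := Homs X
  id o := match o with
    | V => PUnit.unit
    | A => (1 : Equiv.Perm X)
  comp {a b c} f g := match a, b, c, f, g with
    | V, V, V, _, _ => PUnit.unit
    | V, V, A, _, x => x
    | V, A, V, _, e => e.elim
    | V, A, A, x, σ => show X from (show Equiv.Perm X from σ) (show X from x)
    | A, V, _, e, _ => e.elim
    | A, A, V, _, e => e.elim
    | A, A, A, σ, τ => show Equiv.Perm X from (show Equiv.Perm X from τ) * (show Equiv.Perm X from σ)
  id_comp {a b} f := by
    cases a <;> cases b <;>
      first
        | exact f.elim
        | rfl
        | exact mul_one (show Equiv.Perm X from f)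
  comp_id {a b} f := by
    cases a <;> cases b <;>
      first
        | exact f.elim
        | rfl
        | exact one_mul (show Equiv.Perm X from f)
  assoc {a b c d} f g h := by
    cases a <;> cases b <;> cases c <;> cases d <;>
      first
        | exact f.elim
        | exact g.elim
        | exact h.elim
        | rfl
        | exact (mul_assoc (show Equiv.Perm X from h) (show Equiv.Perm X from g)
            (show Equiv.Perm X from f)).symm

end PObj

/-- The interpretation functor `I : 𝔾_{(X, Aut X)} ⥤ Set ↓ Π̲_X`: `V ↦ (∅, 1, !)`,
`A ↦ (1, X, ⌜q⌝)` where `q` is the class of `id_X` in `Π̲_X(X)`. -/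
def InterpPi (X : Type) : PObj X ⥤ PiGraph X where
  obj o := match o with
    | .V => ⟨Empty, PUnit, TypeCat.ofHom fun e => e.elim⟩
    | .A => ⟨PUnit, X, TypeCat.ofHom fun _ => Quot.mk _ id⟩
  map {a b} f := match a, b, f with
    | .V, .V, _ => 𝟙 _
    | .V, .A, x =>
        { left := TypeCat.ofHom fun e => e.elim
          right := TypeCat.ofHom fun _ => (show X from x)
          w := by ext e; exact e.elim }
    | .A, .V, e => e.elim
    | .A, .A, σ =>
        { left := TypeCat.ofHom id
          right := TypeCat.ofHom (show Equiv.Perm X from σ)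
          w := by
            ext u
            exact Quot.sound (r := fun f g : X → X => ∃ τ : Equiv.Perm X, f = g ∘ τ)
              ⟨(show Equiv.Perm X from σ)⁻¹, by
                funext y; exact ((show Equiv.Perm X from σ).apply_symm_apply y).symm⟩ }
  map_id o := by
    cases o
    · rfl
    · apply CommaMorphism.ext <;> rfl
  map_comp {a b c} f g := by
    cases a <;> cases b <;> cases c <;>
      first
        | exact f.elim
        | exact g.elim
        | apply CommaMorphism.ext <;> rfl

namespace CategoryTheory.Presheaf

universe v₁ u₁ u₂

variable {C : Type u₁} [Category.{v₁} C] {ℰ : Type u₂} [Category.{v₁} ℰ] (A : C ⥤ ℰ)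

/-- Mathlib's former `Presheaf.restrictedYoneda`: the functor `E ↦ (c ↦ (A.obj c ⟶ E))`. -/
def restrictedYoneda : ℰ ⥤ Cᵒᵖ ⥤ Type v₁ :=
  yoneda ⋙ (Functor.whiskeringLeft _ _ (Type v₁)).obj (Functor.op A)

/-- Mathlib's former `Presheaf.restrictedYonedaHomEquiv'`. -/
def restrictedYonedaHomEquiv' (P : Cᵒᵖ ⥤ Type v₁) (E : ℰ) :
    (CostructuredArrow.proj yoneda P ⋙ A ⟶
      (Functor.const (CostructuredArrow yoneda P)).obj E) ≃
      (P ⟶ (restrictedYoneda A).obj E) where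
  toFun f :=
    { app := fun _ => TypeCat.ofHom fun x => f.app (CostructuredArrow.mk (yonedaEquiv.symm x))
      naturality := fun X₁ X₂ g => by
        ext x
        let φ : CostructuredArrow.mk (yonedaEquiv.symm (P.map g x)) ⟶
          CostructuredArrow.mk (yonedaEquiv.symm x) :=
            CostructuredArrow.homMk g.unop (yonedaEquiv_symm_map g x).symm
        have h := f.naturality φ
        exact ((h.trans (Category.comp_id _)).symm :) }
  invFun g :=
    { app := fun y => yonedaEquiv (y.hom ≫ g)
      naturality := fun y y' f => by
        have h := CostructuredArrow.w f
        have h2 : yonedaEquiv (y.hom ≫ g) =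
            ((restrictedYoneda A).obj E).map f.left.op (yonedaEquiv (y'.hom ≫ g)) := by
          rw [← h, Category.assoc]
          exact (yonedaEquiv_naturality (y'.hom ≫ g) f.left).symm
        exact (h2.symm.trans (Category.comp_id _).symm :) }
  left_inv f := by
    apply NatTrans.ext
    funext y
    let φ : CostructuredArrow.mk (yonedaEquiv.symm (yonedaEquiv y.hom)) ⟶ y :=
      CostructuredArrow.homMk (𝟙 y.left) (by
        rw [Equiv.symm_apply_apply]
        exact (congrArg (· ≫ y.hom) (yoneda.map_id y.left)).trans (Category.id_comp _))
    have h := f.naturality φ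
    have h2 : A.map (𝟙 y.left) ≫ f.app y =
      f.app (CostructuredArrow.mk (yonedaEquiv.symm (yonedaEquiv y.hom))) :=
        h.trans (Category.comp_id _)
    rw [A.map_id] at h2
    exact (h2.symm.trans (Category.id_comp _) :)
  right_inv g := by
    ext X x
    change yonedaEquiv (yonedaEquiv.symm x ≫ g) = g.app X x
    rw [yonedaEquiv_comp, Equiv.apply_symm_apply]

variable {A}
variable [yoneda.HasPointwiseLeftKanExtension A]
variable (L : (Cᵒᵖ ⥤ Type v₁) ⥤ ℰ) (α : A ⟶ yoneda ⋙ L) [L.IsLeftKanExtension α]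

/-- Mathlib's former `Presheaf.restrictedYonedaHomEquiv`. -/
noncomputable def restrictedYonedaHomEquiv (P : Cᵒᵖ ⥤ Type v₁) (E : ℰ) :
    (L.obj P ⟶ E) ≃ (P ⟶ (restrictedYoneda A).obj E) :=
  (Functor.isPointwiseLeftKanExtensionOfIsLeftKanExtension _ α P).homEquiv.trans
    (restrictedYonedaHomEquiv' A P E)

/-- Mathlib's former `Presheaf.yonedaAdjunction`: a (pointwise) left Kan extension `L` of `A`
along the Yoneda embedding is left adjoint to `restrictedYoneda A`. -/
noncomputable def yonedaAdjunction : L ⊣ restrictedYoneda A :=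
  Adjunction.mkOfHomEquiv
    { homEquiv := restrictedYonedaHomEquiv L α
      homEquiv_naturality_left_symm := fun {P Q X} f g => by
        apply (Functor.isPointwiseLeftKanExtensionOfIsLeftKanExtension L α P).hom_ext
        intro p
        have hfg := (Functor.isPointwiseLeftKanExtensionOfIsLeftKanExtension
          L α P).comp_homEquiv_symm ((restrictedYonedaHomEquiv' A P X).symm (f ≫ g)) p
        have hg := (Functor.isPointwiseLeftKanExtensionOfIsLeftKanExtension
          L α Q).comp_homEquiv_symm ((restrictedYonedaHomEquiv' A Q X).symm g)
            ((CostructuredArrow.map f).obj p)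
        have e : ((restrictedYonedaHomEquiv' A P X).symm (f ≫ g)).app p =
            ((restrictedYonedaHomEquiv' A Q X).symm g).app
              ((CostructuredArrow.map f).obj p) := rfl
        have key {Z : ℰ} (k : L.obj Q ⟶ Z) :
            α.app p.left ≫ L.map (p.hom ≫ f) ≫ k =
              (α.app p.left ≫ L.map p.hom) ≫ L.map f ≫ k := by
          rw [L.map_comp, Category.assoc, Category.assoc]
        exact (Category.assoc _ _ _).trans (hfg.trans (e.trans (hg.symm.trans (key _))))
      homEquiv_naturality_right := fun {P X Y} f g => by
        ext c x
        exact (Category.assoc _ _ _).symm }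

end CategoryTheory.Presheaf

/-- The nerve `N := Hom(I(−), −) : Set ↓ Π̲_X ⥤ presheaves on 𝔾_{(X, Aut X)}`. -/
noncomputable def nervePi (X : Type) : PiGraph X ⥤ ((PObj X)ᵒᵖ ⥤ Type) :=
  Presheaf.restrictedYoneda (InterpPi X)

/-- The nerve–realization adjunction `R ⊣ N` induced by the interpretation
`I : 𝔾_{(X, Aut X)} ⥤ Set ↓ Π̲_X`, where `R` is the left Kan extension of `I` along the
Yoneda embedding and `N = Hom(I(−), −)` is the nerve. -/
noncomputable def nerveRealizationAdj (X : Type) :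
    yoneda.leftKanExtension (InterpPi X) ⊣ nervePi X :=
  Presheaf.yonedaAdjunction (yoneda.leftKanExtension (InterpPi X))
    (yoneda.leftKanExtensionUnit (InterpPi X))


namespace PObj

/-- The arrow `V ⟶ A` given by `x`. -/
def vx {X : Type} (x : X) : (PObj.V : PObj X) ⟶ PObj.A := x

/-- The endomorphism of `A` given by `σ`. -/
def sg {X : Type} (σ : Equiv.Perm X) : (PObj.A : PObj X) ⟶ PObj.A := σ

end PObj

open PObj

theorem nt_nat {X : Type} {P Q : (PObj X)ᵒᵖ ⥤ Type} (g : P ⟶ Q) {a b : PObj X} (f : a ⟶ b)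
    (p : P.obj (op b)) : g.app (op a) (P.map f.op p) = Q.map f.op (g.app (op b) p) :=
  congrArg (fun h => h p) (g.naturality f.op)

theorem quot_exact {X Y : Type} {f g : X → Y}
    (h : Quot.mk (fun f g : X → Y => ∃ σ : Equiv.Perm X, f = g ∘ σ) f = Quot.mk _ g) :
    ∃ σ : Equiv.Perm X, f = g ∘ σ := by
  have he : Equivalence (fun f g : X → Y => ∃ σ : Equiv.Perm X, f = g ∘ σ) := by
    refine ⟨fun f => ⟨1, rfl⟩, ?_, ?_⟩
    · rintro f g ⟨σ, rfl⟩
      exact ⟨σ⁻¹, by funext x; simp⟩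
    · rintro f g h ⟨σ, rfl⟩ ⟨τ, rfl⟩
      exact ⟨τ * σ, rfl⟩
  exact he.quot_mk_eq_iff _ _ |>.1 h

/-- Vertices of the nerve. -/
def nv {X : Type} (G : PiGraph X) (v : G.right) : (InterpPi X).obj PObj.V ⟶ G where
  left := TypeCat.ofHom fun e : Empty => e.elim
  right := TypeCat.ofHom fun _ : PUnit => v
  w := by ext e; exact Empty.elim e

/-- Arcs of the nerve. -/
def na {X : Type} (G : PiGraph X) (e : G.left) (f : X → G.right)
    (h : G.hom e = Quot.mk _ f) : (InterpPi X).obj PObj.A ⟶ G where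
  left := TypeCat.ofHom fun _ : PUnit => e
  right := TypeCat.ofHom f
  w := by ext u; exact h

/-- The vertex underlying an element of the nerve. -/
def vtx {X : Type} {G : PiGraph X} (m : (InterpPi X).obj PObj.V ⟶ G) : G.right :=
  (show PUnit ⟶ G.right from m.right) PUnit.unit

def edg {X : Type} {G : PiGraph X} (m : (InterpPi X).obj PObj.A ⟶ G) : G.left :=
  (show PUnit ⟶ G.left from m.left) PUnit.unit

def bd {X : Type} {G : PiGraph X} (m : (InterpPi X).obj PObj.A ⟶ G) (x : X) : G.right :=
  (show X ⟶ G.right from m.right) x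

theorem vext {X : Type} {G : PiGraph X} {m n : (InterpPi X).obj PObj.V ⟶ G}
    (h : vtx m = vtx n) : m = n := by
  apply CommaMorphism.ext
  · ext e; exact Empty.elim e
  · ext e; exact h

theorem aext {X : Type} {G : PiGraph X} {m n : (InterpPi X).obj PObj.A ⟶ G}
    (h : edg m = edg n) (h' : ∀ x, bd m x = bd n x) : m = n := by
  apply CommaMorphism.ext
  · ext e; exact h
  · ext e; exact h' e

theorem edg_bd {X : Type} {G : PiGraph X} (m : (InterpPi X).obj PObj.A ⟶ G) :
    G.hom (edg m) = Quot.mk _ (bd m) :=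
  congrArg (fun k => k PUnit.unit) m.w

theorem nerve_full_faithful (X : Type) : (nervePi X).Full ∧ (nervePi X).Faithful := by
  constructor
  · refine ⟨fun {G H} g => ?_⟩
    let gv : ((InterpPi X).obj PObj.V ⟶ G) → ((InterpPi X).obj PObj.V ⟶ H) :=
      fun m => g.app (op PObj.V) m
    let ga : ((InterpPi X).obj PObj.A ⟶ G) → ((InterpPi X).obj PObj.A ⟶ H) :=
      fun m => g.app (op PObj.A) m
    have nvx : ∀ (x : X) m, gv ((InterpPi X).map (vx x) ≫ m) = (InterpPi X).map (vx x) ≫ ga m :=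
      fun x m => nt_nat g (vx x) m
    have nsg : ∀ (s : Equiv.Perm X) m,
        ga ((InterpPi X).map (sg s) ≫ m) = (InterpPi X).map (sg s) ≫ ga m :=
      fun s m => nt_nat g (sg s) m
    let r : G.right → H.right := fun v => vtx (gv (nv G v))
    have hgv : ∀ m, vtx (gv m) = r (vtx m) := fun m => by
      have : m = nv G (vtx m) := vext rfl
      exact congrArg (fun m => vtx (gv m)) this
    have hbd : ∀ m x, bd (ga m) x = r (bd m x) := fun m x => by
      have h1 := congrArg vtx (nvx x m)
      rw [hgv] at h1
      exact h1.symm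
    have hed : ∀ m n, edg m = edg n → edg (ga m) = edg (ga n) := fun m n h => by
      have h1 := edg_bd m
      rw [h, edg_bd n] at h1
      obtain ⟨s, hs⟩ := quot_exact h1
      have : n = (InterpPi X).map (sg s) ≫ m := by
        exact aext h.symm (fun x => congrFun hs x)
      rw [this, nsg]
      rfl
    have hex : ∀ e : G.left, ∃ m : (InterpPi X).obj PObj.A ⟶ G, edg m = e := fun e => by
      obtain ⟨f, hf⟩ := Quot.exists_rep (G.hom e)
      exact ⟨na G e f hf.symm, rfl⟩
    choose c hc using hex
    let k : G ⟶ H :=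
      { left := TypeCat.ofHom fun e => edg (ga (c e))
        right := TypeCat.ofHom r
        w := by
          ext e
          have h1 := edg_bd (ga (c e))
          have h2 := edg_bd (c e)
          rw [hc] at h2
          have h3 : bd (ga (c e)) = r ∘ bd (c e) := funext (hbd (c e))
          rw [h3] at h1
          refine h1.trans ?_
          change _ = (PiXF X).map (TypeCat.ofHom r) (G.hom e)
          rw [h2]
          rfl }
    refine ⟨k, ?_⟩
    ext ⟨o⟩ m
    cases o with
    | V => exact vext (hgv m).symm
    | A => exact aext (hed _ _ (hc _)) (fun x => (hbd m x).symm)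
  · refine ⟨fun {G H} f g h => ?_⟩
    apply CommaMorphism.ext
    · ext e
      obtain ⟨b, hf⟩ := Quot.exists_rep (G.hom e)
      have := congrArg (fun k => k.app (op PObj.A) (na G e b hf.symm)) h
      exact congrArg edg this
    · ext v
      have := congrArg (fun k => k.app (op PObj.V) (nv G v)) h
      exact congrArg vtx this

/-- The boundary of an arc of a presheaf. -/
def pbd {X : Type} (P : (PObj X)ᵒᵖ ⥤ Type) (a : P.obj (op PObj.A)) (x : X) : P.obj (op PObj.V) :=
  P.map (vx x).op a

theorem pbd_sg {X : Type} (P : (PObj X)ᵒᵖ ⥤ Type) (a : P.obj (op PObj.A)) (s : Equiv.Perm X) :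
    pbd P (P.map (sg s).op a) = pbd P a ∘ s := by
  funext x
  have : vx x ≫ sg s = vx (s x) := rfl
  change P.map (vx x).op (P.map (sg s).op a) = P.map (vx (s x)).op a
  rw [← this, op_comp, P.map_comp]
  rfl

/-- The explicit realization. -/
def rz {X : Type} (P : (PObj X)ᵒᵖ ⥤ Type) : PiGraph X where
  left := Quot (fun a b : P.obj (op PObj.A) => ∃ s : Equiv.Perm X, a = P.map (sg s).op b)
  right := P.obj (op PObj.V)
  hom := TypeCat.ofHom (Quot.lift (fun a => (Quot.mk _ (pbd P a) : (PiXF X).obj _)) (by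
    rintro a b ⟨s, rfl⟩
    exact Quot.sound ⟨s, pbd_sg P b s⟩))

/-- The explicit unit. -/
def un {X : Type} (P : (PObj X)ᵒᵖ ⥤ Type) : P ⟶ (nervePi X).obj (rz P) where
  app o := match o with
    | ⟨.V⟩ => TypeCat.ofHom fun v => nv (rz P) v
    | ⟨.A⟩ => TypeCat.ofHom fun a => na (rz P) (Quot.mk _ a) (pbd P a) rfl
  naturality := by
    rintro ⟨a⟩ ⟨b⟩ f
    obtain ⟨f, rfl⟩ : ∃ g : b ⟶ a, f = g.op := ⟨f.unop, rfl⟩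
    cases a <;> cases b
    · ext v
      refine vext ?_
      obtain rfl : f = 𝟙 _ := rfl
      change P.map (𝟙 _) v = v
      simp
    · exact PEmpty.elim f
    · ext v
      exact vext rfl
    · ext a
      refine aext (Quot.sound ⟨f, rfl⟩) (fun x => congrFun (pbd_sg P a f) x)

theorem un_V {X : Type} (P : (PObj X)ᵒᵖ ⥤ Type) :
    Function.Bijective ((un P).app (op PObj.V)) :=
  ⟨fun _ _ h => congrArg vtx h, fun m => ⟨vtx m, vext rfl⟩⟩

theorem un_A {X : Type} (P : (PObj X)ᵒᵖ ⥤ Type) :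
    Function.Surjective ((un P).app (op PObj.A)) := by
  intro m
  obtain ⟨a, ha⟩ := Quot.exists_rep (edg (G := rz P) m)
  have h1 := edg_bd (G := rz P) m
  rw [← ha] at h1
  obtain ⟨s, hs⟩ := quot_exact h1.symm
  refine ⟨P.map (sg s).op a, ?_⟩
  refine aext (G := rz P) ?_ ?_
  · exact Eq.trans (Quot.sound ⟨s, rfl⟩) ha
  · intro x
    rw [hs]
    exact congrFun (pbd_sg P a s) x

theorem epi_of {X : Type} {P Q : (PObj X)ᵒᵖ ⥤ Type} (g : P ⟶ Q)
    (hV : Function.Surjective (g.app (op PObj.V)))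
    (hA : Function.Surjective (g.app (op PObj.A))) : Epi g := by
  have : ∀ o, Epi (g.app o) := by
    rintro ⟨o⟩
    cases o
    · exact (epi_iff_surjective _).2 hV
    · exact (epi_iff_surjective _).2 hA
  exact NatTrans.epi_of_epi_app g

theorem un_fac {X : Type} (P : (PObj X)ᵒᵖ ⥤ Type) (E : PiGraph X)
    (g : P ⟶ (nervePi X).obj E) : ∃ h : rz P ⟶ E, un P ≫ (nervePi X).map h = g := by
  have hb : ∀ a x, bd (G := E) (g.app (op PObj.A) a) x
      = vtx (G := E) (g.app (op PObj.V) (pbd P a x)) := fun a x =>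
    (congrArg (vtx (G := E)) (nt_nat g (vx x) a)).symm
  refine ⟨{ left := TypeCat.ofHom (Quot.lift (fun a => edg (G := E) (g.app (op PObj.A) a)) ?_)
            right := TypeCat.ofHom fun v => vtx (G := E) (g.app (op PObj.V) v)
            w := ?_ }, ?_⟩
  · rintro a b ⟨s, rfl⟩
    have h1 := congrArg (edg (G := E)) (nt_nat g (sg s) b)
    exact h1.trans rfl
  · ext q
    induction q using Quot.ind with
    | _ a =>
      refine (edg_bd (G := E) (g.app (op PObj.A) a)).trans ?_
      exact congrArg (Quot.mk _) (funext (hb a))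
  · ext ⟨o⟩ p
    cases o with
    | V => exact vext (G := E) rfl
    | A => exact aext (G := E) rfl (fun x => (hb p x).symm)

theorem statement19 (X : Type) (P : (PObj X)ᵒᵖ ⥤ Type) :
    Function.Bijective (((nerveRealizationAdj X).unit.app P).app (op PObj.V)) ∧
    Function.Surjective (((nerveRealizationAdj X).unit.app P).app (op PObj.A)) ∧
    Epi ((nerveRealizationAdj X).unit.app P) ∧
    (nervePi X).Full ∧ (nervePi X).Faithful := by
  obtain ⟨hfull, hfaith⟩ := nerve_full_faithful X
  generalize nerveRealizationAdj X = adj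
  have hepi : Epi (un P) := epi_of _ (un_V P).2 (un_A P)
  obtain ⟨h, hh⟩ := un_fac P _ (adj.unit.app P)
  obtain ⟨k, hk⟩ := (adj.homEquiv P (rz P)).surjective (un P)
  rw [Adjunction.homEquiv_unit] at hk
  have e1 : h ≫ k = 𝟙 _ := by
    apply (nervePi X).map_injective
    rw [← cancel_epi (un P), Functor.map_comp, ← Category.assoc, hh, hk]
    simp
  have e2 : k ≫ h = 𝟙 _ := by
    apply (adj.homEquiv P _).injective
    rw [Adjunction.homEquiv_unit, Adjunction.homEquiv_unit, Functor.map_comp,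
      ← Category.assoc, hk, hh]
    simp
  have : IsIso h := ⟨k, e1, e2⟩
  have hb : ∀ o, Function.Bijective (((nervePi X).map h).app o) := fun o =>
    (isIso_iff_bijective _).1 inferInstance
  have hV : Function.Bijective ((adj.unit.app P).app (op PObj.V)) := by
    rw [← hh]
    exact (hb _).comp (un_V P)
  have hA : Function.Surjective ((adj.unit.app P).app (op PObj.A)) := by
    rw [← hh]
    exact (hb _).2.comp (un_A P)
  exact ⟨hV, hA, epi_of _ hV.2 hA, hfull, hfaith⟩
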